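/- Let λ and γ be infinite cardinals and κ ≥ 1 a cardinal. If the (λ,κ,γ)-hat game is winning, then the (ω,κ,γ)-hat game is winning. -/

import Mathlib

open Cardinal Set

universe u v

/-- `f` depends on only finitely many coordinates of its argument; this is exactly continuity
with respect to the product topology on `ι → C`, where `C` and `X` carry the discrete topology. -/
def FinDep {ι : Type v} {C : Type u} {X : Type*} (f : (ι → C) → X) : Prop :=
  ∀ h : ι → C, ∃ F : Finset ι, ∀ h' : ι → C, (∀ i ∈ F, h' i = h i) → f h' = f h

/-- A strategy in the hat game with logicians `L`, colours `C` and `< γ` many guesses: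
each logician `a : L` produces a set of fewer than `γ` colours as guesses, where the guess is a
continuous function of the hats of the other logicians (in particular it depends on only finitely
many of the other hats, and never on the logician's own hat). -/
structure HatStrategy (L : Type v) (C : Type u) (γ : Cardinal.{u}) where
  guess : L → (L → C) → Set C
  small : ∀ a h, #(guess a h) < γ
  continuous : ∀ a, FinDep (guess a)
  blind : ∀ a : L, ∀ h h' : L → C, (∀ b, b ≠ a → h b = h' b) → guess a h = guess a h'

/-- A strategy is winning if against every colouring some logician guesses their own colour. -/
def HatStrategy.IsWinning {L : Type v} {C : Type u} {γ : Cardinal.{u}}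
    (S : HatStrategy L C γ) : Prop :=
  ∀ h : L → C, ∃ a, h a ∈ S.guess a h

/-- The hat game with logicians `L`, colours `C` and `< γ` many guesses is winning for the
logicians. -/
def HatWinning (L : Type v) (C : Type u) (γ : Cardinal.{u}) : Prop :=
  ∃ S : HatStrategy L C γ, S.IsWinning

/-- The `(λ, κ, γ)`-hat game is winning: `λ`-many logicians, `κ`-many colours,
`< γ` many guesses. -/
def HatGameWinning (lam κ γ : Cardinal.{u}) : Prop :=
  HatWinning lam.out κ.out γ

universe w

/-- A well-founded decision tree querying coordinates in `L`, receiving answers in `C`. -/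
inductive QueryTree (L : Type v) (C : Type u) (X : Type w)
  | leaf (x : X) : QueryTree L C X
  | node (b : L) (next : C → QueryTree L C X) : QueryTree L C X

namespace QueryTree

variable {L : Type v} {C : Type u} {X : Type w}

/-- The leaf reached when the queries are answered according to `h`. -/
def eval : QueryTree L C X → (L → C) → X
  | leaf x, _ => x
  | node b next, h => (next (h b)).eval h

/-- The `k`-th query made when the answers are given by `h`, or `d` if there is none. -/
def query (d : L) : QueryTree L C X → (L → C) → ℕ → L
  | leaf _, _, _ => d
  | node b _, _, 0 => b
  | node b next, h, k + 1 => (next (h b)).query d h k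

/-- No query of the tree lies in `P`. -/
def Avoids (P : Set L) : QueryTree L C X → Prop
  | leaf _ => True
  | node b next => b ∉ P ∧ ∀ c, (next c).Avoids P

open Classical in
/-- Answer the queries in `P` in advance according to `x`. -/
noncomputable def prune (P : Set L) (x : L → C) : QueryTree L C X → QueryTree L C X
  | leaf y => leaf y
  | node b next => if b ∈ P then (next (x b)).prune P x else node b fun c => (next c).prune P x

theorem avoids_prune (P : Set L) (x : L → C) (t : QueryTree L C X) :
    (t.prune P x).Avoids P := by
  induction t with
  | leaf y => trivial
  | node b next ih =>
    by_cases hb : b ∈ P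
    · simpa [prune, hb] using ih _
    · simpa [prune, hb, Avoids] using ih

open Classical in
theorem eval_prune (P : Set L) (x h : L → C) (t : QueryTree L C X) :
    (t.prune P x).eval h = t.eval (P.piecewise x h) := by
  induction t with
  | leaf y => rfl
  | node b next ih => by_cases hb : b ∈ P <;> simp [prune, hb, eval, ih]

theorem Avoids.mono {P Q : Set L} (hPQ : P ⊆ Q) {t : QueryTree L C X} (ht : t.Avoids Q) :
    t.Avoids P := by
  induction t with
  | leaf y => trivial
  | node b next ih => exact ⟨fun hb => ht.1 (hPQ hb), fun c => ih c (ht.2 c)⟩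

theorem Avoids.query_notMem {P : Set L} {d : L} (hd : d ∉ P) {t : QueryTree L C X}
    (ht : t.Avoids P) (h : L → C) (k : ℕ) : t.query d h k ∉ P := by
  induction t generalizing k with
  | leaf y => exact hd
  | node b next ih =>
    cases k with
    | zero => exact ht.1
    | succ k => exact ih _ (ht.2 _) k

theorem query_congr (d : L) {t : QueryTree L C X} {g h : L → C} {k : ℕ}
    (H : ∀ j < k, g (t.query d h j) = h (t.query d h j)) : t.query d g k = t.query d h k := by
  induction t generalizing k with
  | leaf y => rfl
  | node b next ih =>
    cases k with
    | zero => rfl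
    | succ k =>
      have h0 : g b = h b := H 0 k.succ_pos
      simp only [query, h0]
      exact ih _ fun j hj => H (j + 1) (Nat.succ_lt_succ hj)

theorem eval_congr (d : L) {t : QueryTree L C X} {g h : L → C}
    (H : ∀ j, g (t.query d h j) = h (t.query d h j)) : t.eval g = t.eval h := by
  induction t with
  | leaf y => rfl
  | node b next ih =>
    have h0 : g b = h b := H 0
    simp only [eval, h0]
    exact ih _ fun j => H (j + 1)

/-- The union of all leaves with fewer than `γ` elements that can be reached when the `k`-th
answer is taken from `K k`. -/
def reach (γ : Cardinal.{u}) : QueryTree L C (Set C) → (ℕ → Finset C) → Set C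
  | leaf s, _ => {c | c ∈ s ∧ #s < γ}
  | node _ next, K => ⋃ c ∈ K 0, (next c).reach γ fun k => K (k + 1)

theorem mk_reach_lt {γ : Cardinal.{u}} (hγ : ℵ₀ ≤ γ) (t : QueryTree L C (Set C))
    (K : ℕ → Finset C) : #(t.reach γ K) < γ := by
  classical
  induction t generalizing K with
  | leaf s =>
    by_cases hs : #s < γ
    · exact (mk_le_mk_of_subset fun c hc => hc.1).trans_lt hs
    · simpa [reach, hs] using aleph0_pos.trans_le hγ
  | node b next ih =>
    have key : ∀ F : Finset C, #(⋃ c ∈ F, (next c).reach γ fun k => K (k + 1) : Set C) < γ := by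
      intro F
      induction F using Finset.induction_on with
      | empty => simpa using aleph0_pos.trans_le hγ
      | insert c F _ hF =>
        rw [Finset.set_biUnion_insert]
        exact (mk_union_le _ _).trans_lt (add_lt_of_lt hγ (ih _ _) hF)
    exact key (K 0)

theorem exists_reach_congr (γ : Cardinal.{u}) (t : QueryTree L C (Set C)) (K : ℕ → Finset C) :
    ∃ N : ℕ, ∀ K' : ℕ → Finset C, (∀ k < N, K' k = K k) → t.reach γ K' = t.reach γ K := by
  induction t generalizing K with
  | leaf s => exact ⟨0, fun _ _ => rfl⟩
  | node b next ih =>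
    choose N hN using fun c => ih c fun k => K (k + 1)
    refine ⟨(K 0).sup N + 1, fun K' hK' => ?_⟩
    simp only [reach, hK' 0 (Nat.succ_pos _)]
    refine iUnion₂_congr fun c hc => hN c _ fun k hk => hK' _ ?_
    exact Nat.succ_lt_succ (hk.trans_le (Finset.le_sup hc))

theorem eval_subset_reach {γ : Cardinal.{u}} {P : Set L} (d : L) {t : QueryTree L C (Set C)}
    (ht : t.Avoids P) {h : L → C} {K : ℕ → Finset C}
    (hK : ∀ k, t.query d h k ∉ P → h (t.query d h k) ∈ K k) (hs : #(t.eval h) < γ) :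
    t.eval h ⊆ t.reach γ K := by
  induction t generalizing K with
  | leaf s => exact fun c hc => ⟨hc, hs⟩
  | node b next ih =>
    refine (ih (h b) (ht.2 _) (fun k => hK (k + 1)) hs).trans ?_
    exact subset_biUnion_of_mem (u := fun c => (next c).reach γ fun k => K (k + 1))
      (show h b ∈ (K 0 : Set C) from hK 0 ht.1)

end QueryTree

/-- `f` is computed by a decision tree on the colourings agreeing with `h` on `D`. -/
def TreeComputable {L : Type v} {C : Type u} {X : Type w} (f : (L → C) → X) (D : Finset L)
    (h : L → C) : Prop :=
  ∃ t : QueryTree L C X, ∀ g : L → C, (∀ i ∈ D, g i = h i) → t.eval g = f g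

section TreeComputable

variable {L : Type v} {C : Type u} {X : Type w} {f : (L → C) → X} {D : Finset L} {h : L → C}

open Classical in
theorem exists_not_treeComputable_insert (hD : ¬ TreeComputable f D h) (b : L) :
    ∃ g : L → C, (∀ i ∈ D, g i = h i) ∧ ¬ TreeComputable f (insert b D) g := by
  by_contra! H
  have hc : ∀ c, ∃ t : QueryTree L C X, ∀ g : L → C, (∀ i ∈ D, g i = h i) → g b = c →
      t.eval g = f g := by
    intro c
    by_cases hex : ∃ g : L → C, (∀ i ∈ D, g i = h i) ∧ g b = c
    · obtain ⟨g, hg, rfl⟩ := hex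
      obtain ⟨t, ht⟩ := H g hg
      refine ⟨t, fun g' hg' hb => ht g' fun i hi => ?_⟩
      rcases Finset.mem_insert.1 hi with rfl | hi
      · exact hb
      · rw [hg' i hi, hg i hi]
    · exact ⟨.leaf (f h), fun g hg hb => (hex ⟨g, hg, hb⟩).elim⟩
  choose t ht using hc
  exact hD ⟨.node b t, fun g hg => ht (g b) g hg rfl⟩

open Classical in
theorem exists_not_treeComputable_union (hD : ¬ TreeComputable f D h) (E : Finset L) :
    ∃ g : L → C, (∀ i ∈ D, g i = h i) ∧ ¬ TreeComputable f (D ∪ E) g := by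
  induction E using Finset.induction_on with
  | empty => exact ⟨h, fun _ _ => rfl, by simpa using hD⟩
  | insert b E _ ih =>
    obtain ⟨g, hg, hgD⟩ := ih
    obtain ⟨g', hg', hgD'⟩ := exists_not_treeComputable_insert hgD b
    refine ⟨g', fun i hi => (hg' i (Finset.mem_union_left _ hi)).trans (hg i hi), ?_⟩
    rwa [Finset.union_insert]

theorem FinDep.exists_not_treeComputable_meeting (hf : FinDep f) (hD : ¬ TreeComputable f D h) :
    ∃ (D' : Finset L) (h' : L → C), D ⊆ D' ∧ (∀ i ∈ D, h' i = h i) ∧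
      ¬ TreeComputable f D' h' ∧ ∀ (g : L → C) (F : Finset L), (∀ i ∈ D, g i = h i) →
        (∀ g' : L → C, (∀ i ∈ F, g' i = g i) → f g' = f g) → ∃ b ∈ F, b ∉ D ∧ b ∈ D' := by
  classical
  obtain ⟨h₁, hh, hne⟩ : ∃ h₁ : L → C, (∀ i ∈ D, h₁ i = h i) ∧ f h₁ ≠ f h := by
    by_contra! H
    exact hD ⟨.leaf (f h), fun g hg => (H g hg).symm⟩
  obtain ⟨F₀, hF₀⟩ := hf h
  obtain ⟨F₁, hF₁⟩ := hf h₁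
  obtain ⟨h', hh', hD'⟩ := exists_not_treeComputable_union hD (F₀ ∪ F₁)
  refine ⟨_, h', Finset.subset_union_left, hh', hD', fun g F hg hF => ?_⟩
  by_contra! H
  have main : ∀ (k : L → C) (E : Finset L), (∀ i ∈ D, k i = h i) → E ⊆ F₀ ∪ F₁ →
      (∀ k' : L → C, (∀ i ∈ E, k' i = k i) → f k' = f k) → f k = f g := by
    intro k E hk hE hkE
    let m : L → C := fun i => if i ∈ F then g i else k i
    rw [← hkE m fun i hi => ?_, hF m fun i hi => if_pos hi]
    by_cases hiF : i ∈ F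
    · have hiD : i ∈ D := by
        by_contra hiD
        exact H i hiF hiD (Finset.mem_union_right _ (hE hi))
      simp [m, hiF, hg i hiD, hk i hiD]
    · simp [m, hiF]
  exact hne ((main h₁ F₁ hh Finset.subset_union_right hF₁).trans
    (main h F₀ (fun _ _ => rfl) Finset.subset_union_left hF₀).symm)

/-- A continuous function between (powers of) discrete spaces is computed by a decision tree. -/
theorem FinDep.exists_queryTree [Nonempty C] (hf : FinDep f) :
    ∃ t : QueryTree L C X, ∀ g, t.eval g = f g := by
  classical
  by_contra! H
  have h₀ : ¬ TreeComputable f ∅ fun _ => Classical.arbitrary C := by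
    rintro ⟨t, ht⟩
    obtain ⟨g, hg⟩ := H t
    exact hg (ht g (by simp))
  choose D' h' hsub hagree hnot hmeet using
    fun p : {p : Finset L × (L → C) // ¬ TreeComputable f p.1 p.2} =>
      hf.exists_not_treeComputable_meeting p.2
  let s : ℕ → {p : Finset L × (L → C) // ¬ TreeComputable f p.1 p.2} :=
    fun n => Nat.rec ⟨(∅, _), h₀⟩ (fun _ p => ⟨(D' p, h' p), hnot p⟩) n
  have hmono : Monotone fun n => (s n).1.1 := monotone_nat_of_le_succ fun n => hsub (s n)
  have hs : ∀ m n, m ≤ n → ∀ i ∈ (s m).1.1, (s n).1.2 i = (s m).1.2 i := by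
    intro m n hmn i hi
    induction n, hmn using Nat.le_induction with
    | base => rfl
    | succ n hmn ih => exact (hagree (s n) i (hmono hmn hi)).trans ih
  let g : L → C := fun i =>
    if hi : ∃ n, i ∈ (s n).1.1 then (s (Nat.find hi)).1.2 i else Classical.arbitrary C
  have hg : ∀ n, ∀ i ∈ (s n).1.1, g i = (s n).1.2 i := by
    intro n i hi
    have hex : ∃ n, i ∈ (s n).1.1 := ⟨n, hi⟩
    simp only [g, dif_pos hex]
    exact (hs _ n (Nat.find_min' hex hi) i (Nat.find_spec hex)).symm
  obtain ⟨F, hF⟩ := hf g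
  have hcard : ∀ n, (F \ (s n).1.1).card + n ≤ F.card := by
    intro n
    induction n with
    | zero => exact Finset.card_le_card Finset.sdiff_subset
    | succ n ih =>
      obtain ⟨b, hbF, hbD, hbD'⟩ := hmeet (s n) g F (hg n) hF
      have hlt : (F \ (s (n + 1)).1.1).card < (F \ (s n).1.1).card := by
        refine Finset.card_lt_card (Finset.ssubset_iff_of_subset
          (Finset.sdiff_subset_sdiff le_rfl (hmono n.le_succ)) |>.2 ⟨b, ?_, ?_⟩)
        · exact Finset.mem_sdiff.2 ⟨hbF, hbD⟩
        · exact fun hb => (Finset.mem_sdiff.1 hb).2 hbD'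
      omega
  have := hcard (F.card + 1)
  omega

end TreeComputable

section FirstNames

variable {L : Type v} {C : Type u} {X : Type w}

open Classical in
/-- Colour `b` by the colour of the first of its names that is less than `n`. -/
noncomputable def firstColour (d : C) (c : ℕ → C) (n : ℕ) (a : (u : ℕ) → u < n → L) (b : L) : C :=
  if hb : ∃ u, ∃ hu : u < n, a u hu = b then c (Nat.find hb) else d

/-- Name elements of `L` by natural numbers: `0` names `a₀`, and `Nat.pair m k + 1` names the
`k`-th query of the tree of the element named `m`. Queries are answered with the colour, given
by `c`, of the first name of the queried element. -/
noncomputable def treeNames (T : L → QueryTree L C X) (a₀ : L) (d : C) (c : ℕ → C) : ℕ → L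
  | 0 => a₀
  | n + 1 =>
    (T (treeNames T a₀ d c n.unpair.1)).query a₀
      (firstColour d c (n + 1) fun u _ => treeNames T a₀ d c u) n.unpair.2
  termination_by n => n
  decreasing_by
    · exact Nat.lt_succ_of_le n.unpair_left_le
    · assumption

variable (T : L → QueryTree L C X) (a₀ : L) (d : C)

theorem treeNames_congr {c c' : ℕ → C} (n : ℕ) (hc : ∀ u < n, c u = c' u) :
    treeNames T a₀ d c n = treeNames T a₀ d c' n := by
  classical
  induction n using Nat.strong_induction_on with
  | _ n ih =>
    cases n with
    | zero => rw [treeNames, treeNames]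
    | succ n =>
      have ih' : ∀ u < n + 1, treeNames T a₀ d c u = treeNames T a₀ d c' u :=
        fun u hu => ih u hu fun v hv => hc v (hv.trans hu)
      rw [treeNames, treeNames, ih' _ (Nat.lt_succ_of_le n.unpair_left_le)]
      congr 1
      have hfun : (fun u (_ : u < n + 1) => treeNames T a₀ d c u) =
          fun u _ => treeNames T a₀ d c' u := by
        funext u hu
        exact ih' u hu
      rw [hfun]
      funext b
      by_cases hb : ∃ u, ∃ hu : u < n + 1, treeNames T a₀ d c' u = b
      · rw [firstColour, firstColour, dif_pos hb, dif_pos hb]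
        exact hc _ (Nat.find_spec hb).1
      · rw [firstColour, firstColour, dif_neg hb, dif_neg hb]

open Classical in
/-- The colouring giving each named element the colour of its first name. -/
noncomputable def namedColouring (c : ℕ → C) (b : L) : C :=
  if hb : ∃ u, treeNames T a₀ d c u = b then c (Nat.find hb) else d

theorem exists_namedColouring_eq (c : ℕ → C) (n : ℕ) :
    ∃ u ≤ n, treeNames T a₀ d c u = treeNames T a₀ d c n ∧
      namedColouring T a₀ d c (treeNames T a₀ d c n) = c u := by
  classical
  have hb : ∃ u, treeNames T a₀ d c u = treeNames T a₀ d c n := ⟨n, rfl⟩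
  exact ⟨Nat.find hb, Nat.find_min' hb rfl, Nat.find_spec hb, dif_pos hb⟩

theorem firstColour_treeNames (c : ℕ → C) {m n : ℕ} (hm : m < n) :
    firstColour d c n (fun u _ => treeNames T a₀ d c u) (treeNames T a₀ d c m) =
      namedColouring T a₀ d c (treeNames T a₀ d c m) := by
  classical
  have hb : ∃ u, treeNames T a₀ d c u = treeNames T a₀ d c m := ⟨m, rfl⟩
  have hb' : ∃ u, ∃ _ : u < n, treeNames T a₀ d c u = treeNames T a₀ d c m := ⟨m, hm, rfl⟩
  rw [firstColour, namedColouring, dif_pos hb, dif_pos hb']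
  congr 1
  refine le_antisymm (Nat.find_min' hb' ⟨?_, Nat.find_spec hb⟩)
    (Nat.find_min' hb (Nat.find_spec hb').2)
  exact (Nat.find_min' hb rfl).trans_lt hm

theorem treeNames_pair_succ (c : ℕ → C) (m k : ℕ) :
    treeNames T a₀ d c (Nat.pair m k + 1) =
      (T (treeNames T a₀ d c m)).query a₀ (namedColouring T a₀ d c) k := by
  induction k using Nat.strong_induction_on with
  | _ k ih =>
    rw [treeNames, Nat.unpair_pair]
    refine QueryTree.query_congr _ fun j hj => ?_
    rw [← ih j hj]
    exact firstColour_treeNames T a₀ d c (Nat.succ_lt_succ (Nat.pair_lt_pair_right m hj))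

theorem treeNames_notMem {P : Set L} (ha₀ : a₀ ∉ P) (hT : ∀ a, (T a).Avoids P) (c : ℕ → C)
    (n : ℕ) : treeNames T a₀ d c n ∉ P := by
  cases n with
  | zero => rwa [treeNames]
  | succ n =>
    rw [treeNames]
    exact (hT _).query_notMem ha₀ _ _

open Classical in
/-- The strategy on `ℕ` in which `n` guesses everything that the logician named `n` could guess,
the answer to the `k`-th query being the colour of some other name `≤ Nat.pair n k + 1`. -/
noncomputable def treeStrategy (T : L → QueryTree L C (Set C)) (a₀ : L) (d : C)
    {γ : Cardinal.{u}} (hγ : ℵ₀ ≤ γ) : HatStrategy ℕ C γ where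
  guess n c := (T (treeNames T a₀ d c n)).reach γ
    fun k => ((Finset.range (Nat.pair n k + 2)).erase n).image c
  small _ _ := QueryTree.mk_reach_lt hγ _ _
  continuous n c := by
    obtain ⟨N, hN⟩ := (T (treeNames T a₀ d c n)).exists_reach_congr γ
      fun k => ((Finset.range (Nat.pair n k + 2)).erase n).image c
    refine ⟨Finset.range n ∪ (Finset.range N).biUnion fun k => Finset.range (Nat.pair n k + 2),
      fun c' hc' => ?_⟩
    simp only [treeNames_congr T a₀ d n fun u hu =>
      hc' u (Finset.mem_union_left _ (Finset.mem_range.2 hu))]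
    refine hN _ fun k hk => Finset.image_congr fun u hu => hc' u ?_
    exact Finset.mem_union_right _
      (Finset.mem_biUnion.2 ⟨k, Finset.mem_range.2 hk, Finset.mem_of_mem_erase hu⟩)
  blind n c c' hcc' := by
    simp only [treeNames_congr T a₀ d n fun u hu => hcc' u hu.ne]
    congr 1
    funext k
    exact Finset.image_congr fun u hu => hcc' u (Finset.ne_of_mem_erase hu)

end FirstNames

namespace HatStrategy

variable {L : Type v} {C : Type u} {γ : Cardinal.{u}}

/-- No logician in `A` guesses correctly, for any colouring agreeing with `x` on `A`. -/
def LosesOn (S : HatStrategy L C γ) (A : Set L) (x : L → C) : Prop :=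
  ∀ a ∈ A, ∀ y : L → C, (∀ b ∈ A, y b = x b) → y a ∉ S.guess a y

theorem LosesOn.exists_extension [Nonempty C] (hγ : ℵ₀ ≤ γ) (hlose : ¬ HatWinning ℕ C γ)
    {S : HatStrategy L C γ} {A : Set L} {x : L → C} (hA : S.LosesOn A x) {a₀ : L} (ha₀ : a₀ ∉ A) :
    ∃ (B : Set L) (y : L → C), A ⊆ B ∧ a₀ ∈ B ∧ (∀ b ∈ A, y b = x b) ∧ S.LosesOn B y := by
  classical
  choose T₀ hT₀ using fun a => (S.continuous a).exists_queryTree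
  let T : L → QueryTree L C (Set C) := fun a => (T₀ a).prune (insert a A) x
  have hT : ∀ a, (T a).Avoids (insert a A) := fun a => QueryTree.avoids_prune _ _ _
  have hTA : ∀ a, (T a).Avoids A := fun a => (hT a).mono (subset_insert a A)
  have hTeval : ∀ a (y : L → C), (∀ b ∈ A, y b = x b) → (T a).eval y = S.guess a y := by
    intro a y hy
    rw [QueryTree.eval_prune, hT₀]
    refine S.blind a _ _ fun b hb => ?_
    by_cases hbA : b ∈ A
    · simp [hbA, hy b hbA]
    · simp [hb, hbA]
  let d : C := Classical.arbitrary C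
  obtain ⟨c, hc⟩ : ∃ c : ℕ → C, ∀ n, c n ∉ (treeStrategy T a₀ d hγ).guess n c := by
    by_contra! H
    exact hlose ⟨_, H⟩
  let a := treeNames T a₀ d c
  let z := namedColouring T a₀ d c
  have haA : ∀ n, a n ∉ A := treeNames_notMem T a₀ d ha₀ hTA c
  refine ⟨A ∪ range a, A.piecewise x z, subset_union_left, Or.inr ⟨0, by simp only [a, treeNames]⟩,
    fun b hb => by simp [hb], ?_⟩
  have hext : ∀ y : L → C, (∀ b ∈ A ∪ range a, y b = A.piecewise x z b) →
      (∀ b ∈ A, y b = x b) ∧ ∀ n, y (a n) = z (a n) := by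
    intro y hy
    refine ⟨fun b hb => ?_, fun n => ?_⟩
    · simpa [hb] using hy b (Or.inl hb)
    · simpa [haA n] using hy (a n) (Or.inr ⟨n, rfl⟩)
  rintro b (hb | ⟨m, rfl⟩) y hy
  · exact hA b hb y (hext y hy).1
  obtain ⟨hyA, hya⟩ := hext y hy
  obtain ⟨n, -, hnm, hzn⟩ : ∃ n ≤ m, a n = a m ∧ z (a m) = c n :=
    exists_namedColouring_eq T a₀ d c m
  have hquery : ∀ k, (T (a n)).query a₀ z k = a (Nat.pair n k + 1) := fun k =>
    (treeNames_pair_succ T a₀ d c n k).symm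
  have heval : S.guess (a n) y = (T (a n)).eval z := by
    rw [← hTeval _ y hyA]
    exact QueryTree.eval_congr a₀ fun k => by rw [hquery, hya]
  rw [hya, hzn, ← hnm]
  refine fun hmem => hc n (QueryTree.eval_subset_reach a₀ (hT _) (h := z) ?_ ?_ (heval ▸ hmem))
  · intro k hk
    change (T (a n)).query a₀ z k ∉ _ at hk
    change z ((T (a n)).query a₀ z k) ∈ _
    rw [hquery] at hk ⊢
    obtain ⟨u, hu, hau, hzu⟩ : ∃ u ≤ Nat.pair n k + 1,
        a u = a (Nat.pair n k + 1) ∧ z (a (Nat.pair n k + 1)) = c u :=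
      exists_namedColouring_eq T a₀ d c _
    rw [hzu]
    refine Finset.mem_image_of_mem _ (Finset.mem_erase.2 ⟨?_, Finset.mem_range.2 (by omega)⟩)
    rintro rfl
    exact hk (Or.inl hau.symm)
  · exact heval ▸ S.small _ _

theorem exists_losesOn_univ [Nonempty C] (hγ : ℵ₀ ≤ γ) (hlose : ¬ HatWinning ℕ C γ)
    (S : HatStrategy L C γ) : ∃ x : L → C, S.LosesOn Set.univ x := by
  classical
  let r : {p : Set L × (L → C) // S.LosesOn p.1 p.2} →
      {p : Set L × (L → C) // S.LosesOn p.1 p.2} → Prop :=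
    fun p q => p.1.1 ⊆ q.1.1 ∧ ∀ b ∈ p.1.1, q.1.2 b = p.1.2 b
  obtain ⟨⟨⟨A, x⟩, hA⟩, hmax⟩ : ∃ m, ∀ p, r m p → r p m := by
    refine exists_maximal_of_chains_bounded (fun s hs => ?_) fun {p q t} hpq hqt =>
      ⟨hpq.1.trans hqt.1, fun b hb => (hqt.2 b (hpq.1 hb)).trans (hpq.2 b hb)⟩
    let y : L → C := fun b =>
      if hb : ∃ p ∈ s, b ∈ p.1.1 then hb.choose.1.2 b else Classical.arbitrary C
    have hy : ∀ p ∈ s, ∀ b ∈ p.1.1, y b = p.1.2 b := by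
      intro p hp b hb
      have hex : ∃ p ∈ s, b ∈ p.1.1 := ⟨p, hp, hb⟩
      simp only [y, dif_pos hex]
      obtain ⟨hq, hbq⟩ := hex.choose_spec
      rcases eq_or_ne p hex.choose with h | h
      · rw [← h]
      · rcases hs hp hq h with h | h
        · exact h.2 b hb
        · exact (h.2 b hbq).symm
    refine ⟨⟨(⋃ p ∈ s, p.1.1, y), ?_⟩, fun p hp => ⟨subset_biUnion_of_mem
      (u := fun p : {p : Set L × (L → C) // S.LosesOn p.1 p.2} => p.1.1) hp, hy p hp⟩⟩
    intro b hb z hz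
    obtain ⟨p, hp, hbp⟩ := mem_iUnion₂.1 hb
    exact p.2 b hbp z fun i hi => (hz i (mem_biUnion hp hi)).trans (hy p hp i hi)
  suffices h : A = Set.univ from ⟨x, h ▸ hA⟩
  refine eq_univ_of_forall fun a₀ => ?_
  by_contra ha₀
  obtain ⟨B, y, hAB, ha₀B, hy, hB⟩ := hA.exists_extension hγ hlose ha₀
  exact ha₀ ((hmax ⟨(B, y), hB⟩ ⟨hAB, hy⟩).1 ha₀B)

end HatStrategy

/-- For infinite `λ` and `γ` and `κ ≥ 1`: if the `(λ,κ,γ)`-hat game is winning then so is the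
`(ω,κ,γ)`-hat game. -/
theorem stmt11 (lam γ κ : Cardinal.{u}) (hlam : ℵ₀ ≤ lam) (hγ : ℵ₀ ≤ γ) (hκ : 1 ≤ κ) :
    HatGameWinning lam κ γ → HatWinning ℕ κ.out γ := by
  rintro ⟨S, hS⟩
  by_contra hlose
  have : Nonempty κ.out := by
    rw [← mk_ne_zero_iff, mk_out]
    exact (zero_lt_one.trans_le hκ).ne'
  obtain ⟨x, hx⟩ := S.exists_losesOn_univ hγ hlose
  obtain ⟨a, ha⟩ := hS x
  exact hx a (mem_univ a) x (fun _ _ => rfl) ha
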